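/- arXiv:2501.15306 — 2 statements merged into one kernel-verified Lean document; each statement's English description precedes it below -/
import Mathlib

section
/- Let a ∈ (-5/2, -2), b ∈ (0,1), and t ∈ ℝ. Define 𝒟^b h(x) = ( ∫_ℝ |h(x)-h(y)|²/|x-y|^{1+2b} dy )^{1/2} for the function h(x) = e^{i t x |x|^{1+a}}. Then there is a constant C, independent of x and t, such that for all x ≠ 0, 𝒟^b( e^{i t x |x|^{1+a}} )(x) ≤ C ⟨t⟩ |x|^{(1+a) b}, where ⟨t⟩ = (1+t²)^{1/2}. -/
open MeasureTheory ENNReal Real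

/-- The one-dimensional Stein derivative of order `b`:
`𝒟^b h(x) = (∫ |h(x)-h(y)|²/|x-y|^{1+2b} dy)^{1/2}`. -/
noncomputable def steinDeriv1 (b : ℝ) (h : ℝ → ℂ) (x : ℝ) : ℝ≥0∞ :=
  (∫⁻ y, (‖h x - h y‖₊ : ℝ≥0∞) ^ (2 : ℕ) /
      (‖x - y‖₊ : ℝ≥0∞) ^ (1 + 2 * b) ∂volume) ^ ((1 : ℝ) / 2)

/-- The function `|v| ^ p` cut off to `|v| ≤ 1`. -/
noncomputable def absRpowNear (p v : ℝ) : ℝ := (Set.Iic (1 : ℝ)).indicator (fun r => r ^ p) ‖v‖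

/-- The function `|v| ^ q` cut off to `|v| > c`. -/
noncomputable def absRpowFar (c q v : ℝ) : ℝ := (Set.Ioi c).indicator (fun r => r ^ q) ‖v‖

lemma absRpowNear_nonneg (p v : ℝ) : 0 ≤ absRpowNear p v :=
  Set.indicator_apply_nonneg fun _ => Real.rpow_nonneg (norm_nonneg _) _

lemma absRpowFar_nonneg (c q v : ℝ) : 0 ≤ absRpowFar c q v :=
  Set.indicator_apply_nonneg fun _ => Real.rpow_nonneg (norm_nonneg _) _

lemma absRpowNear_of_le {p v : ℝ} (hv : |v| ≤ 1) : absRpowNear p v = |v| ^ p := by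
  simp [absRpowNear, hv]

lemma absRpowFar_of_lt {c q v : ℝ} (hv : c < |v|) : absRpowFar c q v = |v| ^ q := by
  simp [absRpowFar, hv]

lemma integrable_absRpowNear {p : ℝ} (hp : -1 < p) : Integrable (absRpowNear p) := by
  unfold absRpowNear
  rw [integrable_fun_norm_addHaar (μ := (volume : Measure ℝ))
    (f := (Set.Iic (1 : ℝ)).indicator (fun r => r ^ p))]
  simp only [Module.finrank_self, Nat.sub_self, pow_zero, one_smul]
  rw [integrableOn_indicator_iff measurableSet_Iic, Set.inter_comm, Set.Ioi_inter_Iic,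
    ← intervalIntegrable_iff_integrableOn_Ioc_of_le zero_le_one]
  exact intervalIntegral.intervalIntegrable_rpow' hp

lemma integrable_absRpowFar {c q : ℝ} (hc : 0 < c) (hq : q < -1) :
    Integrable (absRpowFar c q) := by
  unfold absRpowFar
  rw [integrable_fun_norm_addHaar (μ := (volume : Measure ℝ))
    (f := (Set.Ioi c).indicator (fun r => r ^ q))]
  simp only [Module.finrank_self, Nat.sub_self, pow_zero, one_smul]
  rw [integrableOn_indicator_iff measurableSet_Ioi, Set.Ioi_inter_Ioi, sup_eq_left.2 hc.le]
  exact integrableOn_Ioi_rpow_of_lt hq hc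

lemma norm_exp_I_mul_sub_exp_I_mul_le_two (α β : ℝ) :
    ‖Complex.exp (Complex.I * α) - Complex.exp (Complex.I * β)‖ ≤ 2 := by
  refine (norm_sub_le _ _).trans ?_
  rw [mul_comm, mul_comm Complex.I, Complex.norm_exp_ofReal_mul_I, Complex.norm_exp_ofReal_mul_I]
  norm_num

lemma norm_exp_I_mul_sub_exp_I_mul_le_abs_sub (α β : ℝ) :
    ‖Complex.exp (Complex.I * α) - Complex.exp (Complex.I * β)‖ ≤ |α - β| := by
  have h : Complex.exp (Complex.I * α) - Complex.exp (Complex.I * β)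
      = Complex.exp (β * Complex.I) * (Complex.exp (Complex.I * ((α - β : ℝ) : ℂ)) - 1) := by
    rw [mul_sub, ← Complex.exp_add, mul_one, mul_comm (β : ℂ)]
    congr 2
    push_cast
    ring
  rw [h, norm_mul, Complex.norm_exp_ofReal_mul_I, one_mul]
  exact Real.norm_exp_I_mul_ofReal_sub_one_le

lemma abs_one_sub_mul_abs_rpow_le {a u : ℝ} (ha1 : -(5 / 2) < a) (ha2 : a < -2)
    (hu : |1 - u| ≤ 1 / 2) : |1 - u * |u| ^ (1 + a)| ≤ 2 * |1 - u| := by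
  obtain ⟨h1, h2⟩ := abs_le.1 hu
  have hu0 : 0 < u := by linarith
  have hφ : u * |u| ^ (1 + a) = u ^ (2 + a) := by
    rw [abs_of_pos hu0, show 2 + a = 1 + (1 + a) by ring, Real.rpow_add hu0 1 (1 + a),
      Real.rpow_one]
  have hinv : u * u⁻¹ = 1 := mul_inv_cancel₀ hu0.ne'
  have hinv0 : 0 < u⁻¹ := inv_pos.2 hu0
  rw [hφ]
  rcases le_total 1 u with h | h
  · have h3 : u ^ (2 + a) ≤ 1 := Real.rpow_le_one_of_one_le_of_nonpos h (by linarith)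
    have h4 : u⁻¹ ≤ u ^ (2 + a) := by
      rw [← Real.rpow_neg_one]; exact Real.rpow_le_rpow_of_exponent_le h (by linarith)
    rw [abs_of_nonneg (by linarith), abs_of_nonpos (by linarith)]
    nlinarith
  · have h3 : 1 ≤ u ^ (2 + a) := Real.one_le_rpow_of_pos_of_le_one_of_nonpos hu0 h (by linarith)
    have h4 : u ^ (2 + a) ≤ u⁻¹ := by
      rw [← Real.rpow_neg_one]; exact Real.rpow_le_rpow_of_exponent_ge hu0 h (by linarith)
    rw [abs_of_nonpos (by linarith), abs_of_nonneg (by linarith)]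
    nlinarith

lemma sq_one_sub_mul_abs_rpow_le {a : ℝ} (ha2 : a < -2) (u : ℝ) :
    (1 - u * |u| ^ (1 + a)) ^ 2 ≤ 2 + 2 * |u| ^ (2 * (2 + a)) := by
  have h : (u * |u| ^ (1 + a)) ^ 2 = |u| ^ (2 * (2 + a)) := by
    rcases eq_or_ne u 0 with rfl | hu
    · simp [Real.zero_rpow (show 2 * (2 + a) ≠ 0 by linarith)]
    · have hu' : 0 < |u| := abs_pos.2 hu
      rw [mul_pow, ← sq_abs u, ← Real.rpow_natCast (|u| ^ (1 + a)), ← Real.rpow_mul hu'.le,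
        ← Real.rpow_natCast |u|, ← Real.rpow_add hu']
      congr 1
      push_cast
      ring
  rw [← h]
  nlinarith [sq_nonneg (1 + u * |u| ^ (1 + a))]

/-- Majorant of `min 4 (4 v²) / |v| ^ (1 + 2b)`. -/
noncomputable def innerMajorant (b v : ℝ) : ℝ :=
  4 * absRpowNear (1 - 2 * b) v + 4 * absRpowFar 1 (-(1 + 2 * b)) v

/-- Majorant of the contribution of `|1 - u| > 1/2`. -/
noncomputable def outerMajorant (a b u : ℝ) : ℝ :=
  64 * absRpowNear (2 * (2 + a)) u + 16 * absRpowFar (1 / 2) (-(1 + 2 * b)) (1 - u)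

lemma innerMajorant_nonneg (b v : ℝ) : 0 ≤ innerMajorant b v := by
  have := absRpowNear_nonneg (1 - 2 * b) v
  have := absRpowFar_nonneg 1 (-(1 + 2 * b)) v
  unfold innerMajorant
  positivity

lemma outerMajorant_nonneg (a b u : ℝ) : 0 ≤ outerMajorant a b u := by
  have := absRpowNear_nonneg (2 * (2 + a)) u
  have := absRpowFar_nonneg (1 / 2) (-(1 + 2 * b)) (1 - u)
  unfold outerMajorant
  positivity

lemma integrable_innerMajorant {b : ℝ} (hb0 : 0 < b) (hb1 : b < 1) :
    Integrable (innerMajorant b) :=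
  ((integrable_absRpowNear (by linarith)).const_mul 4).add
    ((integrable_absRpowFar one_pos (by linarith)).const_mul 4)

lemma integrable_outerMajorant {a b : ℝ} (ha1 : -(5 / 2) < a) (hb0 : 0 < b) :
    Integrable (outerMajorant a b) :=
  ((integrable_absRpowNear (by linarith)).const_mul 64).add
    (((integrable_absRpowFar (by norm_num) (by linarith)).comp_sub_left 1).const_mul 16)

lemma mul_rpow_le_innerMajorant {b v N : ℝ} (hv : v ≠ 0) (h4 : N ≤ 4)
    (hN : N ≤ 4 * v ^ 2) : N * |v| ^ (-(1 + 2 * b)) ≤ innerMajorant b v := by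
  have hv' : 0 < |v| := abs_pos.2 hv
  have hR : 0 ≤ |v| ^ (-(1 + 2 * b)) := Real.rpow_nonneg hv'.le _
  unfold innerMajorant
  rcases le_or_gt |v| 1 with h | h
  · have hexp : |v| ^ (1 - 2 * b) = v ^ 2 * |v| ^ (-(1 + 2 * b)) := by
      rw [← sq_abs v, ← Real.rpow_natCast |v|, ← Real.rpow_add hv']
      congr 1
      push_cast
      ring
    rw [absRpowNear_of_le h, hexp]
    nlinarith [mul_le_mul_of_nonneg_right hN hR, absRpowFar_nonneg 1 (-(1 + 2 * b)) v]
  · rw [absRpowFar_of_lt h]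
    nlinarith [mul_le_mul_of_nonneg_right h4 hR, absRpowNear_nonneg (1 - 2 * b) v]

lemma le_mul_rpow_of_le_of_le_sq_mul {b τ X N : ℝ} (hb0 : 0 < b) (hb1 : b < 1) (hN0 : 0 ≤ N)
    (hX : 1 ≤ X) (h4 : N ≤ 4) (hN : N ≤ τ ^ 2 * X) : N ≤ 4 * |τ| ^ (2 * b) * X := by
  have h1 : N = N ^ (1 - b) * N ^ b := by
    rw [← Real.rpow_add_of_nonneg hN0 (by linarith) hb0.le]; simp
  have h2 : N ^ (1 - b) ≤ 4 := by
    refine (Real.rpow_le_rpow hN0 h4 (by linarith)).trans ?_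
    simpa using Real.rpow_le_rpow_of_exponent_le (show (1 : ℝ) ≤ 4 by norm_num)
      (show 1 - b ≤ 1 by linarith)
  have h3 : N ^ b ≤ |τ| ^ (2 * b) * X := by
    refine (Real.rpow_le_rpow hN0 hN hb0.le).trans ?_
    rw [Real.mul_rpow (sq_nonneg _) (by linarith), ← sq_abs, ← Real.rpow_natCast,
      ← Real.rpow_mul (abs_nonneg _)]
    push_cast
    gcongr
    simpa using Real.rpow_le_rpow_of_exponent_le hX hb1.le
  rw [h1, mul_assoc]
  exact mul_le_mul h2 h3 (Real.rpow_nonneg hN0 _) (by norm_num)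

lemma mul_rpow_le_outerMajorant {a b u : ℝ} (ha2 : a < -2) (hb0 : 0 < b) (hb1 : b < 1)
    (hu : 1 / 2 < |1 - u|) :
    4 * (2 + 2 * |u| ^ (2 * (2 + a))) * |1 - u| ^ (-(1 + 2 * b)) ≤ outerMajorant a b u := by
  have hR0 : 0 ≤ |1 - u| ^ (-(1 + 2 * b)) := Real.rpow_nonneg (abs_nonneg _) _
  have hP0 : 0 ≤ |u| ^ (2 * (2 + a)) := Real.rpow_nonneg (abs_nonneg _) _
  have hR : |1 - u| ^ (-(1 + 2 * b)) ≤ 8 := by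
    calc |1 - u| ^ (-(1 + 2 * b)) ≤ (1 / 2 : ℝ) ^ (-(1 + 2 * b)) :=
          Real.rpow_le_rpow_of_nonpos (by norm_num) hu.le (by linarith)
      _ = 2 ^ (1 + 2 * b) := by
          rw [one_div, Real.inv_rpow (by norm_num), Real.rpow_neg (by norm_num), inv_inv]
      _ ≤ 2 ^ (3 : ℝ) := Real.rpow_le_rpow_of_exponent_le (by norm_num) (by linarith)
      _ = 8 := by norm_num
  unfold outerMajorant
  rw [absRpowFar_of_lt hu]
  rcases le_or_gt |u| 1 with h | h
  · rw [absRpowNear_of_le h]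
    nlinarith [mul_le_mul_of_nonneg_left hR hP0]
  · have hP : |u| ^ (2 * (2 + a)) ≤ 1 := Real.rpow_le_one_of_one_le_of_nonpos h.le (by linarith)
    nlinarith [mul_le_mul_of_nonneg_right hP hR0, absRpowNear_nonneg (2 * (2 + a)) u]

/-- Majorant of the integrand of the squared Stein derivative at the point `1`, for the phase
`τ u |u| ^ (1 + a)`. -/
noncomputable def steinMajorant (a b τ u : ℝ) : ℝ :=
  |τ| ^ (1 + 2 * b) * innerMajorant b (τ * (1 - u)) + |τ| ^ (2 * b) * outerMajorant a b u

lemma steinMajorant_nonneg (a b τ u : ℝ) : 0 ≤ steinMajorant a b τ u := by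
  have := innerMajorant_nonneg b (τ * (1 - u))
  have := outerMajorant_nonneg a b u
  unfold steinMajorant
  positivity

lemma mul_rpow_le_steinMajorant {a b τ u N : ℝ} (ha1 : -(5 / 2) < a) (ha2 : a < -2)
    (hb0 : 0 < b) (hb1 : b < 1) (hτ : τ ≠ 0) (hu : u ≠ 1) (hN0 : 0 ≤ N) (h4 : N ≤ 4)
    (hN : N ≤ τ ^ 2 * (1 - u * |u| ^ (1 + a)) ^ 2) :
    N * |1 - u| ^ (-(1 + 2 * b)) ≤ steinMajorant a b τ u := by
  have hτ' : 0 < |τ| := abs_pos.2 hτ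
  have hR0 : 0 ≤ |1 - u| ^ (-(1 + 2 * b)) := Real.rpow_nonneg (abs_nonneg _) _
  unfold steinMajorant
  rcases le_or_gt |1 - u| (1 / 2) with h | h
  · have hN' : N ≤ 4 * (τ * (1 - u)) ^ 2 := by
      have := abs_one_sub_mul_abs_rpow_le ha1 ha2 h
      have h5 : (1 - u * |u| ^ (1 + a)) ^ 2 ≤ 4 * (1 - u) ^ 2 := by
        rw [← sq_abs, ← sq_abs (1 - u)]
        nlinarith [abs_nonneg (1 - u * |u| ^ (1 + a))]
      nlinarith [mul_le_mul_of_nonneg_left h5 (sq_nonneg τ)]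
    have key := mul_rpow_le_innerMajorant (b := b) (mul_ne_zero hτ (sub_ne_zero.2 hu.symm)) h4 hN'
    have hsplit : |1 - u| ^ (-(1 + 2 * b))
        = |τ| ^ (1 + 2 * b) * |τ * (1 - u)| ^ (-(1 + 2 * b)) := by
      rw [abs_mul, Real.mul_rpow hτ'.le (abs_nonneg _), ← mul_assoc, ← Real.rpow_add hτ']
      simp
    have := outerMajorant_nonneg a b u
    calc N * |1 - u| ^ (-(1 + 2 * b))
        = |τ| ^ (1 + 2 * b) * (N * |τ * (1 - u)| ^ (-(1 + 2 * b))) := by rw [hsplit]; ring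
      _ ≤ |τ| ^ (1 + 2 * b) * innerMajorant b (τ * (1 - u)) := by gcongr
      _ ≤ _ := le_add_of_nonneg_right (by positivity)
  · have hP0 : 0 ≤ |u| ^ (2 * (2 + a)) := Real.rpow_nonneg (abs_nonneg _) _
    have key := le_mul_rpow_of_le_of_le_sq_mul (τ := τ) (X := 2 + 2 * |u| ^ (2 * (2 + a)))
      hb0 hb1 hN0 (by linarith) h4
      (hN.trans (mul_le_mul_of_nonneg_left (sq_one_sub_mul_abs_rpow_le ha2 u) (sq_nonneg _)))
    have := innerMajorant_nonneg b (τ * (1 - u))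
    calc N * |1 - u| ^ (-(1 + 2 * b))
        ≤ 4 * |τ| ^ (2 * b) * (2 + 2 * |u| ^ (2 * (2 + a))) * |1 - u| ^ (-(1 + 2 * b)) := by
          gcongr
      _ = |τ| ^ (2 * b) * (4 * (2 + 2 * |u| ^ (2 * (2 + a))) * |1 - u| ^ (-(1 + 2 * b))) := by
          ring
      _ ≤ |τ| ^ (2 * b) * outerMajorant a b u := by
          gcongr
          exact mul_rpow_le_outerMajorant ha2 hb0 hb1 h
      _ ≤ _ := le_add_of_nonneg_left (by positivity)

lemma integrable_steinMajorant {a b τ : ℝ} (ha1 : -(5 / 2) < a) (hb0 : 0 < b) (hb1 : b < 1)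
    (hτ : τ ≠ 0) : Integrable (steinMajorant a b τ) :=
  ((((integrable_innerMajorant hb0 hb1).comp_mul_left' hτ).comp_sub_left 1).const_mul _).add
    ((integrable_outerMajorant ha1 hb0).const_mul _)

lemma integral_steinMajorant {a b τ : ℝ} (ha1 : -(5 / 2) < a) (hb0 : 0 < b) (hb1 : b < 1)
    (hτ : τ ≠ 0) : ∫ u, steinMajorant a b τ u
      = |τ| ^ (2 * b) * ((∫ v, innerMajorant b v) + ∫ u, outerMajorant a b u) := by
  have hτ' : 0 < |τ| := abs_pos.2 hτ
  unfold steinMajorant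
  rw [integral_add
    ((((integrable_innerMajorant hb0 hb1).comp_mul_left' hτ).comp_sub_left 1).const_mul _)
    ((integrable_outerMajorant ha1 hb0).const_mul _), integral_const_mul, integral_const_mul,
    integral_sub_left_eq_self (fun v => innerMajorant b (τ * v)) volume 1,
    Measure.integral_comp_mul_left, Real.rpow_add hτ', Real.rpow_one, abs_inv, smul_eq_mul]
  field_simp

lemma stein_integrand_le {a b t x : ℝ} (ha1 : -(5 / 2) < a) (ha2 : a < -2)
    (hb0 : 0 < b) (hb1 : b < 1) (ht : t ≠ 0) (hx : x ≠ 0) (h : ℝ → ℂ)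
    (hh : h = fun z : ℝ => Complex.exp (Complex.I * (t : ℂ) * ((z * |z| ^ (1 + a) : ℝ) : ℂ)))
    (y : ℝ) :
    (‖h x - h y‖₊ : ℝ≥0∞) ^ (2 : ℕ) / (‖x - y‖₊ : ℝ≥0∞) ^ (1 + 2 * b)
      ≤ ENNReal.ofReal (|x| ^ (-(1 + 2 * b)) *
          steinMajorant a b (t * (x * |x| ^ (1 + a))) (y / x)) := by
  have hx' : 0 < |x| := abs_pos.2 hx
  rcases eq_or_ne y x with rfl | hyx
  · simp
  set τ := t * (x * |x| ^ (1 + a)) with hτdef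
  have hτ : τ ≠ 0 := mul_ne_zero ht (mul_ne_zero hx (Real.rpow_pos_of_pos hx' _).ne')
  have hxy : 0 < |x - y| := abs_pos.2 (sub_ne_zero.2 hyx.symm)
  have hu : y / x ≠ 1 := fun h => hyx ((div_eq_one_iff_eq hx).1 h)
  have hyτ : t * (y * |y| ^ (1 + a)) = τ * (y / x * |y / x| ^ (1 + a)) := by
    have : y * |y| ^ (1 + a) = (x * (y / x)) * |x * (y / x)| ^ (1 + a) := by
      rw [mul_div_cancel₀ _ hx]
    rw [this, abs_mul, Real.mul_rpow hx'.le (abs_nonneg _), hτdef]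
    ring
  have hform : ∀ z, h z = Complex.exp (Complex.I * ((t * (z * |z| ^ (1 + a)) : ℝ) : ℂ)) := by
    intro z
    rw [hh]
    push_cast
    ring_nf
  have hN4 : ‖h x - h y‖ ^ 2 ≤ 4 := by
    rw [hform, hform]
    nlinarith [norm_exp_I_mul_sub_exp_I_mul_le_two (t * (x * |x| ^ (1 + a)))
      (t * (y * |y| ^ (1 + a))), norm_nonneg (Complex.exp (Complex.I *
      ((t * (x * |x| ^ (1 + a)) : ℝ) : ℂ)) - Complex.exp (Complex.I *
      ((t * (y * |y| ^ (1 + a)) : ℝ) : ℂ)))]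
  have hN : ‖h x - h y‖ ^ 2 ≤ τ ^ 2 * (1 - y / x * |y / x| ^ (1 + a)) ^ 2 := by
    rw [hform, hform, hyτ, ← mul_pow, ← sq_abs (τ * _)]
    gcongr
    refine (norm_exp_I_mul_sub_exp_I_mul_le_abs_sub _ _).trans (le_of_eq ?_)
    congr 1
    ring
  have key := mul_rpow_le_steinMajorant ha1 ha2 hb0 hb1 hτ hu (by positivity) hN4 hN
  have hscale : (|x - y| ^ (1 + 2 * b))⁻¹
      = |x| ^ (-(1 + 2 * b)) * |1 - y / x| ^ (-(1 + 2 * b)) := by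
    rw [← Real.mul_rpow hx'.le (abs_nonneg _), ← abs_mul, mul_sub, mul_div_cancel₀ _ hx, mul_one,
      Real.rpow_neg (abs_nonneg _)]
  have hlhs : (‖h x - h y‖₊ : ℝ≥0∞) ^ (2 : ℕ) / (‖x - y‖₊ : ℝ≥0∞) ^ (1 + 2 * b)
      = ENNReal.ofReal (‖h x - h y‖ ^ 2 / |x - y| ^ (1 + 2 * b)) := by
    rw [ENNReal.ofReal_div_of_pos (Real.rpow_pos_of_pos hxy _), ENNReal.ofReal_pow (norm_nonneg _),
      ← ENNReal.ofReal_rpow_of_pos hxy, ← Real.norm_eq_abs, ofReal_norm, ofReal_norm]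
    rfl
  rw [hlhs, div_eq_mul_inv, hscale]
  refine ENNReal.ofReal_le_ofReal ?_
  calc _ = |x| ^ (-(1 + 2 * b)) * (‖h x - h y‖ ^ 2 * |1 - y / x| ^ (-(1 + 2 * b))) := by ring
    _ ≤ _ := by gcongr

/-- Pointwise upper bound: for `a ∈ (-5/2,-2)` and `b ∈ (0,1)` there is `C`, independent of `x`
and `t`, such that `𝒟^b(e^{itx|x|^(1+a)})(x) ≤ C ⟨t⟩ |x|^{(1+a)b}` for all `x ≠ 0`. -/
theorem stmt10 (a : ℝ) (ha1 : -(5/2) < a) (ha2 : a < -2) (b : ℝ) (hb0 : 0 < b) (hb1 : b < 1) :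
    ∃ C > 0, ∀ (t x : ℝ), x ≠ 0 →
      steinDeriv1 b
          (fun z : ℝ => Complex.exp (Complex.I * (t : ℂ) * ((z * |z| ^ (1 + a) : ℝ) : ℂ))) x
        ≤ ENNReal.ofReal (C * (1 + t ^ 2) ^ ((1 : ℝ) / 2) * |x| ^ ((1 + a) * b)) := by
  set A := (∫ v, innerMajorant b v) + ∫ u, outerMajorant a b u with hA
  have hA0 : 0 ≤ A := add_nonneg (integral_nonneg fun _ => innerMajorant_nonneg _ _)
    (integral_nonneg fun _ => outerMajorant_nonneg _ _ _)
  refine ⟨(A + 1) ^ ((1 : ℝ) / 2), by positivity, fun t x hx => ?_⟩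
  rcases eq_or_ne t 0 with rfl | ht
  · simp [steinDeriv1]
  have hx' : 0 < |x| := abs_pos.2 hx
  have ht' : 0 < |t| := abs_pos.2 ht
  set τ := t * (x * |x| ^ (1 + a)) with hτdef
  have hτ : τ ≠ 0 := mul_ne_zero ht (mul_ne_zero hx (Real.rpow_pos_of_pos hx' _).ne')
  have hint : ∫ y, |x| ^ (-(1 + 2 * b)) * steinMajorant a b τ (y / x)
      = A * (|t| ^ b * |x| ^ ((1 + a) * b)) ^ 2 := by
    have hτabs : |τ| = |t| * |x| ^ (2 + a) := by
      rw [hτdef, abs_mul, abs_mul, abs_of_pos (Real.rpow_pos_of_pos hx' _),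
        show 2 + a = 1 + (1 + a) by ring, Real.rpow_add hx' 1 (1 + a), Real.rpow_one]
    rw [integral_const_mul, Measure.integral_comp_div, integral_steinMajorant ha1 hb0 hb1 hτ,
      ← hA, hτabs, Real.mul_rpow ht'.le (by positivity), ← Real.rpow_mul hx'.le, mul_pow,
      ← Real.rpow_natCast (|t| ^ b), ← Real.rpow_mul ht'.le,
      ← Real.rpow_natCast (|x| ^ ((1 + a) * b)),
      ← Real.rpow_mul hx'.le, smul_eq_mul]
    have hexp : |x| ^ ((1 + a) * b * ((2 : ℕ) : ℝ))
        = |x| ^ (-(1 + 2 * b)) * |x| * |x| ^ ((2 + a) * (2 * b)) := by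
      rw [← Real.rpow_add_one hx'.ne', ← Real.rpow_add hx']
      congr 1
      push_cast
      ring
    rw [hexp]
    push_cast
    rw [mul_comm b 2]
    ring
  have hsq : ∀ r : ℝ, 0 ≤ r → (r ^ 2) ^ ((1 : ℝ) / 2) = r := fun r hr => by
    rw [← Real.sqrt_eq_rpow, Real.sqrt_sq hr]
  have htb : |t| ^ b ≤ (1 + t ^ 2) ^ ((1 : ℝ) / 2) := by
    calc |t| ^ b = (t ^ 2) ^ (b / 2) := by
          rw [← sq_abs, ← Real.rpow_natCast, ← Real.rpow_mul ht'.le]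
          congr 1
          push_cast
          ring
      _ ≤ (1 + t ^ 2) ^ (b / 2) := by
          gcongr
          linarith
      _ ≤ _ := Real.rpow_le_rpow_of_exponent_le (by nlinarith [sq_nonneg t]) (by linarith)
  unfold steinDeriv1
  calc _ ≤ (∫⁻ y, ENNReal.ofReal (|x| ^ (-(1 + 2 * b)) * steinMajorant a b τ (y / x)))
          ^ ((1 : ℝ) / 2) := by
        gcongr with y
        exact stein_integrand_le ha1 ha2 hb0 hb1 ht hx _ rfl y
    _ = ENNReal.ofReal (A * (|t| ^ b * |x| ^ ((1 + a) * b)) ^ 2) ^ ((1 : ℝ) / 2) := by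
        rw [← ofReal_integral_eq_lintegral_ofReal
          (((integrable_steinMajorant ha1 hb0 hb1 hτ).comp_div hx).const_mul _)
          (Filter.Eventually.of_forall fun y => mul_nonneg (by positivity)
            (steinMajorant_nonneg _ _ _ _)), hint]
    _ = ENNReal.ofReal (A ^ ((1 : ℝ) / 2) * (|t| ^ b * |x| ^ ((1 + a) * b))) := by
        rw [ENNReal.ofReal_rpow_of_nonneg (by positivity) (by norm_num),
          Real.mul_rpow hA0 (by positivity), hsq _ (by positivity)]
    _ ≤ _ := by
        rw [mul_assoc]
        gcongr
        linarith
end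

section
/- Let a ∈ (-5/2, -2), let θ satisfy 1 < θ < -3/(2(1+a)), and let s ≥ 3/(5+2a). Then for all u in the Schwartz class, ‖ D^{(1+a)(θ-1)}( x ∂_x(u²) ) ‖_{L²} ≤ C ( ‖u‖_{H^s}² + ‖⟨x⟩^θ u‖_{L²}² ), where D^s g = (|ξ|^s ĝ)^∨, ⟨x⟩ = (1+x²)^{1/2}, and H^s is the L² Sobolev space. -/
open MeasureTheory FourierTransform Real ENNReal

/-- Plancherel's theorem for Schwartz functions, in terms of `eLpNorm`. -/
lemma SchwartzMap.eLpNorm_fourier_two (f : SchwartzMap ℝ ℂ) :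
    eLpNorm (𝓕 (⇑f)) 2 volume = eLpNorm f 2 volume := by
  have h := SchwartzMap.norm_fourier_toL2_eq f
  rw [SchwartzMap.norm_toLp, SchwartzMap.norm_toLp] at h
  exact (ENNReal.toReal_eq_toReal_iff' ((𝓕 f).memLp 2 volume).2.ne (f.memLp 2 volume).2.ne).mp h

/-- The Fourier transform maps `L¹` to `L^∞`. -/
lemma SchwartzMap.enorm_fourier_le_eLpNorm_one (f : SchwartzMap ℝ ℂ) (ξ : ℝ) :
    ‖𝓕 (⇑f) ξ‖ₑ ≤ eLpNorm f 1 volume := by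
  have h := f.norm_fourier_apply_le_toLp_one ξ
  rw [SchwartzMap.norm_toLp, SchwartzMap.fourier_coe] at h
  rw [← ofReal_norm]
  exact ENNReal.ofReal_le_of_le_toReal h

/-- A Schwartz function is bounded by the `L¹` norm of its Fourier transform. -/
lemma SchwartzMap.enorm_le_eLpNorm_one_fourier (f : SchwartzMap ℝ ℂ) (x : ℝ) :
    ‖f x‖ₑ ≤ eLpNorm (𝓕 (⇑f)) 1 volume := by
  have h := (𝓕 f).enorm_fourier_le_eLpNorm_one (-x)
  rw [← Real.fourierInv_eq_fourier_neg, ← SchwartzMap.fourierInv_coe,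
    FourierTransform.fourierInv_fourier_eq, SchwartzMap.fourier_coe] at h
  exact h

lemma SchwartzMap.fourier_deriv_apply (u : SchwartzMap ℝ ℂ) (ξ : ℝ) :
    𝓕 (deriv u) ξ = (2 * π * Complex.I * ξ) • 𝓕 (⇑u) ξ :=
  congrFun (Real.fourier_deriv u.integrable u.differentiable
    (SchwartzMap.derivCLM ℂ ℂ u).integrable) ξ

/-- `|ξ| ^ α` is square integrable near the origin for `α > -1/2`. -/
lemma eLpNorm_indicator_abs_rpow_lt_top {α : ℝ} (hα : -(1 / 2) < α) :
    eLpNorm ((Set.Ioc (-1 : ℝ) 1).indicator fun ξ => |ξ| ^ α) 2 volume < ⊤ := by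
  have hpos : IntervalIntegrable (fun x : ℝ => |x| ^ (2 * α)) volume 0 1 := by
    refine (intervalIntegral.intervalIntegrable_rpow' (r := 2 * α) (by linarith)).congr ?_
    intro x hx
    rw [Set.uIoc_of_le zero_le_one] at hx
    simp [abs_of_pos hx.1]
  have hneg : IntervalIntegrable (fun x : ℝ => |x| ^ (2 * α)) volume (-1) 0 := by
    have := ((IntervalIntegrable.iff_comp_neg (by simp)).mp hpos).symm
    simpa using this
  have hint := (intervalIntegrable_iff_integrableOn_Ioc_of_le (by norm_num)).mp (hneg.trans hpos)
  have hmeas : AEStronglyMeasurable (fun ξ : ℝ => |ξ| ^ α) (volume.restrict (Set.Ioc (-1) 1)) :=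
    (measurable_id.abs.pow_const α).aestronglyMeasurable
  rw [eLpNorm_indicator_eq_eLpNorm_restrict measurableSet_Ioc]
  refine ((memLp_two_iff_integrable_sq hmeas).mpr (hint.congr ?_)).2
  refine Filter.Eventually.of_forall fun x => ?_
  simp only
  rw [mul_comm, Real.rpow_mul (abs_nonneg x), Real.rpow_two]

/-- The function `(1 + ξ²)⁻¹` is square integrable. -/
lemma eLpNorm_inv_one_add_sq_lt_top :
    eLpNorm (fun ξ : ℝ => (1 + ξ ^ 2)⁻¹) 2 volume < ⊤ := by
  have hc : Continuous fun ξ : ℝ => (1 + ξ ^ 2)⁻¹ :=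
    Continuous.inv₀ (by fun_prop) fun ξ => by positivity
  refine ((memLp_two_iff_integrable_sq hc.aestronglyMeasurable).mpr ?_).2
  refine integrable_inv_one_add_sq.mono' (hc.pow 2).aestronglyMeasurable
    (Filter.Eventually.of_forall fun ξ => ?_)
  rw [Real.norm_of_nonneg (by positivity)]
  exact pow_le_of_le_one (by positivity) (inv_le_one_of_one_le₀ (by nlinarith)) two_ne_zero

/-- Multiplying a Schwartz function by a power of `1 + x²` keeps it in `L²`. -/
lemma SchwartzMap.eLpNorm_one_add_sq_rpow_smul_lt_top (f : SchwartzMap ℝ ℂ) (r : ℝ) :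
    eLpNorm (fun x : ℝ => ((1 + x ^ 2) ^ r : ℝ) • f x) 2 volume < ⊤ := by
  have hg : (fun x : ℝ => (1 + x ^ 2) ^ r).HasTemperateGrowth := by
    simpa using Function.hasTemperateGrowth_one_add_norm_sq_rpow ℝ r
  have h := (SchwartzMap.smulLeftCLM ℂ (fun x : ℝ => (1 + x ^ 2) ^ r) f).eLpNorm_lt_top 2
  rwa [SchwartzMap.smulLeftCLM_apply hg] at h

lemma abs_le_one_add_sq_rpow_half (ξ : ℝ) : |ξ| ≤ (1 + ξ ^ 2) ^ (1 / 2 : ℝ) := by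
  rw [← Real.sqrt_eq_rpow]
  exact Real.abs_le_sqrt (by linarith)

lemma abs_le_one_add_sq_rpow {r : ℝ} (hr : 1 / 2 ≤ r) (ξ : ℝ) : |ξ| ≤ (1 + ξ ^ 2) ^ r :=
  (abs_le_one_add_sq_rpow_half ξ).trans
    (Real.rpow_le_rpow_of_exponent_le (by nlinarith) hr)

lemma abs_le_inv_one_add_sq_mul_rpow {r : ℝ} (hr : 3 / 2 ≤ r) (ξ : ℝ) :
    |ξ| ≤ (1 + ξ ^ 2)⁻¹ * (1 + ξ ^ 2) ^ r := by
  have h : 0 < 1 + ξ ^ 2 := by positivity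
  rw [← Real.rpow_neg_one, ← Real.rpow_add h]
  exact abs_le_one_add_sq_rpow (by linarith) ξ

lemma SchwartzMap.enorm_fourier_deriv (u : SchwartzMap ℝ ℂ) (ξ : ℝ) :
    ‖𝓕 (deriv u) ξ‖ₑ = ENNReal.ofReal (2 * π) * ‖|ξ| • 𝓕 (⇑u) ξ‖ₑ := by
  rw [u.fourier_deriv_apply, ← ofReal_norm, ← ofReal_norm,
    ← ENNReal.ofReal_mul (by positivity)]
  simp [abs_of_pos Real.pi_pos, mul_assoc]

/-- The derivative is bounded in `L²` by the `H^{2r}` norm, for `2r ≥ 1`. -/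
lemma SchwartzMap.eLpNorm_deriv_le (u : SchwartzMap ℝ ℂ) {r : ℝ} (hr : 1 / 2 ≤ r) :
    eLpNorm (deriv u) 2 volume ≤ ENNReal.ofReal (2 * π) *
      eLpNorm (fun ξ : ℝ => ((1 + ξ ^ 2) ^ r : ℝ) • 𝓕 (⇑u) ξ) 2 volume := by
  have h := (SchwartzMap.derivCLM ℂ ℂ u).eLpNorm_fourier_two
  change eLpNorm (𝓕 (deriv u)) 2 volume = eLpNorm (deriv u) 2 volume at h
  rw [← h]
  refine eLpNorm_le_mul_eLpNorm_of_ae_le_mul' (c := (2 * π).toNNReal)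
    (Filter.Eventually.of_forall fun ξ => ?_) 2
  rw [u.enorm_fourier_deriv]
  refine mul_le_mul_right ?_ _
  rw [enorm_smul, enorm_smul]
  refine mul_le_mul_left (enorm_le_iff_norm_le.mpr ?_) _
  rw [Real.norm_of_nonneg (abs_nonneg ξ), Real.norm_of_nonneg (by positivity)]
  exact abs_le_one_add_sq_rpow hr ξ

/-- The derivative is bounded uniformly by the `H^{2r}` norm, for `2r ≥ 3`. -/
lemma SchwartzMap.enorm_deriv_le (u : SchwartzMap ℝ ℂ) {r : ℝ} (hr : 3 / 2 ≤ r) (x : ℝ) :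
    ‖deriv u x‖ₑ ≤ ENNReal.ofReal (2 * π) *
      (eLpNorm (fun ξ : ℝ => (1 + ξ ^ 2)⁻¹) 2 volume *
        eLpNorm (fun ξ : ℝ => ((1 + ξ ^ 2) ^ r : ℝ) • 𝓕 (⇑u) ξ) 2 volume) := by
  have hc : Continuous (𝓕 (⇑u)) := (𝓕 u).continuous
  have hw : Continuous fun ξ : ℝ => (1 + ξ ^ 2) ^ r :=
    Continuous.rpow_const (by fun_prop) fun ξ => .inl (by positivity)
  have hi : Continuous fun ξ : ℝ => (1 + ξ ^ 2)⁻¹ :=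
    Continuous.inv₀ (by fun_prop) fun ξ => by positivity
  refine ((SchwartzMap.derivCLM ℂ ℂ u).enorm_le_eLpNorm_one_fourier x).trans ?_
  change eLpNorm (𝓕 (deriv u)) 1 volume ≤ _
  refine (eLpNorm_le_mul_eLpNorm_of_ae_le_mul' (c := (2 * π).toNNReal)
    (g := (fun ξ : ℝ => (1 + ξ ^ 2)⁻¹) • fun ξ : ℝ => ((1 + ξ ^ 2) ^ r : ℝ) • 𝓕 (⇑u) ξ)
    (Filter.Eventually.of_forall fun ξ => ?_) 1).trans ?_
  · rw [u.enorm_fourier_deriv]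
    refine mul_le_mul_right ?_ _
    simp only [Pi.smul_apply']
    rw [smul_smul, enorm_smul, enorm_smul]
    refine mul_le_mul_left (enorm_le_iff_norm_le.mpr ?_) _
    rw [Real.norm_of_nonneg (abs_nonneg ξ), Real.norm_of_nonneg (by positivity)]
    exact abs_le_inv_one_add_sq_mul_rpow hr ξ
  · exact mul_le_mul_right (eLpNorm_smul_le_mul_eLpNorm (hw.smul hc).aestronglyMeasurable
      hi.aestronglyMeasurable) _

/-- For `α ≤ 0`, the homogeneous `L²` norm of order `α` is controlled by the `L²` and `L¹`
norms. -/
lemma SchwartzMap.eLpNorm_abs_rpow_smul_fourier_le (F : SchwartzMap ℝ ℂ) {α : ℝ} (hα : α ≤ 0) :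
    eLpNorm (fun ξ : ℝ => (|ξ| ^ α : ℝ) • 𝓕 (⇑F) ξ) 2 volume ≤ eLpNorm F 2 volume +
      eLpNorm F 1 volume *
        eLpNorm ((Set.Ioc (-1 : ℝ) 1).indicator fun ξ => |ξ| ^ α) 2 volume := by
  set h : ℝ → ℝ := (Set.Ioc (-1 : ℝ) 1).indicator fun ξ => |ξ| ^ α with hh
  have hmeas : Measurable h := (measurable_id.abs.pow_const α).indicator measurableSet_Ioc
  have hc : Continuous (𝓕 (⇑F)) := (𝓕 F).continuous
  set N : ℝ≥0∞ := eLpNorm F 1 volume with hN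
  calc eLpNorm (fun ξ : ℝ => (|ξ| ^ α : ℝ) • 𝓕 (⇑F) ξ) 2 volume
      ≤ eLpNorm ((fun ξ => ‖𝓕 (⇑F) ξ‖) + fun ξ => ‖𝓕 (⇑F) ξ‖ * h ξ) 2 volume := by
        refine eLpNorm_mono_real fun ξ => ?_
        rw [norm_smul, Real.norm_of_nonneg (by positivity)]
        simp only [Pi.add_apply, hh]
        by_cases hξ : ξ ∈ Set.Ioc (-1 : ℝ) 1
        · rw [Set.indicator_of_mem hξ, mul_comm]
          linarith [norm_nonneg (𝓕 (⇑F) ξ)]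
        · rw [Set.indicator_of_notMem hξ, mul_zero, add_zero]
          refine mul_le_of_le_one_left (norm_nonneg _)
            (Real.rpow_le_one_of_one_le_of_nonpos ?_ hα)
          by_contra! hlt
          exact hξ ⟨(abs_lt.mp hlt).1, (abs_lt.mp hlt).2.le⟩
    _ ≤ eLpNorm (fun ξ => ‖𝓕 (⇑F) ξ‖) 2 volume +
          eLpNorm (fun ξ => ‖𝓕 (⇑F) ξ‖ * h ξ) 2 volume :=
        eLpNorm_add_le hc.norm.aestronglyMeasurable
          (hc.norm.measurable.mul hmeas).aestronglyMeasurable one_le_two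
    _ ≤ eLpNorm F 2 volume + N * eLpNorm h 2 volume := by
        refine add_le_add ?_ ?_
        · rw [eLpNorm_norm, F.eLpNorm_fourier_two]
        · refine eLpNorm_le_mul_eLpNorm_of_ae_le_mul'' 2 hmeas.aestronglyMeasurable
            (Filter.Eventually.of_forall fun ξ => ?_)
          rw [enorm_mul, enorm_norm]
          exact mul_le_mul_left (F.enorm_fourier_le_eLpNorm_one ξ) _

/-- For `a ∈ (-5/2,-2)`, `1 < θ < -3/(2(1+a))` and `s ≥ 3/(5+2a)`, there is `C > 0` such that
for all Schwartz `u`, `‖D^{(1+a)(θ-1)}(x ∂ₓ(u²))‖_{L²} ≤ C(‖u‖_{H^s}² + ‖⟨x⟩^θ u‖_{L²}²)`. -/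
theorem stmt14 (a θ s : ℝ) (ha1 : -(5/2) < a) (ha2 : a < -2)
    (hθ1 : 1 < θ) (hθ2 : θ < -3 / (2 * (1 + a))) (hs : 3 / (5 + 2 * a) ≤ s) :
    ∃ C > 0, ∀ u : SchwartzMap ℝ ℂ,
      eLpNorm (fun ξ : ℝ => (|ξ| ^ ((1 + a) * (θ - 1)) : ℝ) •
          𝓕 (fun x : ℝ => (x : ℂ) * deriv (fun y : ℝ => u y * u y) x) ξ) 2 volume
        ≤ ENNReal.ofReal (C *
            ((eLpNorm (fun ξ : ℝ => ((1 + ξ ^ 2) ^ (s / 2) : ℝ) • 𝓕 (⇑u) ξ) 2 volume).toReal ^ 2 +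
              (eLpNorm (fun x : ℝ => ((1 + x ^ 2) ^ (θ / 2) : ℝ) • u x) 2 volume).toReal ^ 2)) := by
  have hα0 : (1 + a) * (θ - 1) ≤ 0 := by nlinarith
  have hα1 : -(1 / 2) < (1 + a) * (θ - 1) := by
    rw [lt_div_iff_of_neg (by linarith)] at hθ2
    linarith
  have hs3 : 3 / 2 ≤ s / 2 := by
    have : 3 ≤ 3 / (5 + 2 * a) := by
      rw [le_div_iff₀ (by linarith)]
      linarith
    linarith
  set J := eLpNorm ((Set.Ioc (-1 : ℝ) 1).indicator fun ξ => |ξ| ^ ((1 + a) * (θ - 1))) 2 volume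
    with hJ
  set K := eLpNorm (fun ξ : ℝ => (1 + ξ ^ 2)⁻¹) 2 volume with hK
  have hJtop : J ≠ ⊤ := (eLpNorm_indicator_abs_rpow_lt_top hα1).ne
  have hKtop : K ≠ ⊤ := eLpNorm_inv_one_add_sq_lt_top.ne
  set M : ℝ≥0∞ := 2 * ENNReal.ofReal (2 * π) * (K + J) with hM
  have hMtop : M ≠ ⊤ := by finiteness
  refine ⟨M.toReal + 1, by positivity, fun u => ?_⟩
  set A := eLpNorm (fun ξ : ℝ => ((1 + ξ ^ 2) ^ (s / 2) : ℝ) • 𝓕 (⇑u) ξ) 2 volume with hA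
  set B := eLpNorm (fun x : ℝ => ((1 + x ^ 2) ^ (θ / 2) : ℝ) • u x) 2 volume with hB
  have hAtop : A ≠ ⊤ := ((𝓕 u).eLpNorm_one_add_sq_rpow_smul_lt_top (s / 2)).ne
  have hBtop : B ≠ ⊤ := (u.eLpNorm_one_add_sq_rpow_smul_lt_top (θ / 2)).ne
  have hx : (fun x : ℝ => (x : ℂ)).HasTemperateGrowth := Function.Complex.hasTemperateGrowth_ofReal
  set v : SchwartzMap ℝ ℂ := SchwartzMap.derivCLM ℂ ℂ u with hv
  set w : SchwartzMap ℝ ℂ := SchwartzMap.smulLeftCLM ℂ (fun x : ℝ => (x : ℂ)) u with hw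
  set F : SchwartzMap ℝ ℂ := (2 : ℂ) • SchwartzMap.smulLeftCLM ℂ v w with hF
  have hvA : eLpNorm v 2 volume ≤ ENNReal.ofReal (2 * π) * A :=
    u.eLpNorm_deriv_le (by linarith)
  have hwB : eLpNorm w 2 volume ≤ B := by
    refine eLpNorm_mono fun x => ?_
    rw [hw, SchwartzMap.smulLeftCLM_apply_apply hx, norm_smul, norm_smul, Complex.norm_real,
      Real.norm_eq_abs, Real.norm_of_nonneg (by positivity)]
    exact mul_le_mul_of_nonneg_right (abs_le_one_add_sq_rpow (by linarith) x) (norm_nonneg _)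
  have hFcoe : ⇑F = (2 : ℂ) • (⇑v • ⇑w) := by
    ext x
    simp [hF, SchwartzMap.smulLeftCLM_apply_apply v.hasTemperateGrowth]
  have hFeq : (fun x : ℝ => (x : ℂ) * deriv (fun y : ℝ => u y * u y) x) = F := by
    ext x
    have hd : deriv (fun y : ℝ => u y * u y) x = deriv u x * u x + u x * deriv u x :=
      ((u.hasDerivAt x).mul (u.hasDerivAt x)).deriv
    rw [hd, hFcoe, Pi.smul_apply, Pi.smul_apply', hv, hw, SchwartzMap.derivCLM_apply,
      SchwartzMap.smulLeftCLM_apply_apply hx]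
    simp only [smul_eq_mul]
    ring
  have hF2 : eLpNorm F 2 volume ≤ 2 * ENNReal.ofReal (2 * π) * K * (A * B) := by
    rw [hFcoe, eLpNorm_const_smul]
    have h2 : ‖(2 : ℂ)‖ₑ = 2 := by simp [← ofReal_norm]
    have := eLpNorm_le_mul_eLpNorm_of_ae_le_mul'' (f := ⇑v • ⇑w) (μ := volume) 2
      w.continuous.aestronglyMeasurable (Filter.Eventually.of_forall fun x => by
        rw [Pi.smul_apply', enorm_smul]
        exact mul_le_mul_left (u.enorm_deriv_le hs3 x) _)
    calc ‖(2 : ℂ)‖ₑ * eLpNorm (⇑v • ⇑w) 2 volume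
        ≤ 2 * (ENNReal.ofReal (2 * π) * (K * A) * B) := by
          rw [h2]
          exact mul_le_mul_right (this.trans (mul_le_mul_right hwB _)) _
      _ = 2 * ENNReal.ofReal (2 * π) * K * (A * B) := by ring
  have hF1 : eLpNorm F 1 volume ≤ 2 * ENNReal.ofReal (2 * π) * (A * B) := by
    rw [hFcoe, eLpNorm_const_smul]
    have h2 : ‖(2 : ℂ)‖ₑ = 2 := by simp [← ofReal_norm]
    calc ‖(2 : ℂ)‖ₑ * eLpNorm (⇑v • ⇑w) 1 volume
        ≤ 2 * (ENNReal.ofReal (2 * π) * A * B) := by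
          rw [h2]
          exact mul_le_mul_right ((eLpNorm_smul_le_mul_eLpNorm (p := 2) (q := 2)
            w.continuous.aestronglyMeasurable v.continuous.aestronglyMeasurable).trans
              (mul_le_mul' hvA hwB)) _
      _ = 2 * ENNReal.ofReal (2 * π) * (A * B) := by ring
  rw [hFeq]
  calc _ ≤ eLpNorm F 2 volume + eLpNorm F 1 volume * J :=
        F.eLpNorm_abs_rpow_smul_fourier_le hα0
    _ ≤ 2 * ENNReal.ofReal (2 * π) * K * (A * B) + 2 * ENNReal.ofReal (2 * π) * (A * B) * J :=
        add_le_add hF2 (mul_le_mul_left hF1 _)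
    _ = M * (A * B) := by rw [hM]; ring
    _ = ENNReal.ofReal (M.toReal * (A.toReal * B.toReal)) := by
        rw [ENNReal.ofReal_mul toReal_nonneg, ENNReal.ofReal_mul toReal_nonneg,
          ofReal_toReal hMtop, ofReal_toReal hAtop, ofReal_toReal hBtop]
    _ ≤ _ := by
        refine ENNReal.ofReal_le_ofReal (mul_le_mul (by linarith) ?_ (by positivity) (by positivity))
        nlinarith [sq_nonneg (A.toReal - B.toReal), sq_nonneg A.toReal, sq_nonneg B.toReal]
end
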